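/- Let ω be a non-quasianalytic weight function with φ(t) = ω(e^t) and Young conjugate φ*, and let u be a Schwartz function on ℝⁿ. Then the following are equivalent: (1) for every λ > 0 and every multi-index α, sup_{x∈ℝⁿ} e^{λω(|x|)} |D^α u(x)| < ∞ and sup_{ξ∈ℝⁿ} e^{λω(|ξ|)} |D^α û(ξ)| < ∞; (6) for every λ > 0 there exists C_λ > 0 such that sup_{x∈ℝⁿ} |x^β D^α u(x)| ≤ C_λ e^{λφ*(|α+β|/λ)} for all multi-indices α, β. -/

import Mathlib

/-!
STATEMENT 12. Let `ω` be a non-quasianalytic weight function, `φ(t) = ω(e^t)` with Young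
conjugate `φ*`, and `u ∈ 𝓢(ℝⁿ, ℂ)`.  Then condition (1):
  for all `λ > 0` and multi-indices `α`,
  `sup_x e^{λω(|x|)} |D^α u(x)| < ∞` and `sup_ξ e^{λω(|ξ|)} |D^α û(ξ)| < ∞`
is equivalent to condition (6):
  `∀ λ > 0, ∃ C_λ > 0 : sup_x |x^β D^α u(x)| ≤ C_λ e^{λφ*(|α+β|/λ)}` for all `α, β`.
Here `D^α = (-i)^{|α|} ∂^α`, `û(ξ) = ∫ e^{-i⟨x,ξ⟩} u(x) dx`, and
`e^{λφ*(m/λ)} = sup_{s≥0} e^{ms - λω(e^s)}` is formalized as the `ℝ≥0∞`-valued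
`expPhiStar ω λ m` (so that the value `+∞` of `φ*` is handled correctly).
-/

noncomputable section
open MeasureTheory Real SchwartzMap
open scoped ENNReal

/-- A non-quasianalytic weight function. -/
structure IsWeightFn (ω : ℝ → ℝ) : Prop where
  cont : ContinuousOn ω (Set.Ici 0)
  mono : MonotoneOn ω (Set.Ici 0)
  nonneg : ∀ t, 0 ≤ t → 0 ≤ ω t
  alpha : ∃ L > 0, ∀ t, 0 ≤ t → ω (2 * t) ≤ L * (ω t + 1)
  beta : MeasureTheory.IntegrableOn (fun t => ω t / t ^ 2) (Set.Ici 1)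
  gamma : ∃ a : ℝ, ∃ b > 0, ∀ t, 0 ≤ t → a + b * Real.log (1 + t) ≤ ω t
  delta : ConvexOn ℝ (Set.Ici 0) fun t => ω (Real.exp t)

/-- `e^{λ φ*(m/λ)} = sup_{s ≥ 0} e^{m s - λ ω(e^s)} ∈ ℝ≥0∞`. -/
def expPhiStar (ω : ℝ → ℝ) (lam m : ℝ) : ℝ≥0∞ :=
  ⨆ s : Set.Ici (0 : ℝ), ENNReal.ofReal (Real.exp (m * s - lam * ω (Real.exp s)))

variable {n : ℕ}

abbrev En (n : ℕ) := EuclideanSpace ℝ (Fin n)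

def pderivE (i : Fin n) (f : En n → ℂ) : En n → ℂ :=
  fun x => fderiv ℝ f x (EuclideanSpace.single i 1)

/-- The iterated partial derivative `∂^α`. -/
def mpderiv (α : Fin n → ℕ) (f : En n → ℂ) : En n → ℂ :=
  (List.finRange n).foldr (fun i g => (pderivE i)^[α i] g) f

/-- `D^α = (-i)^{|α|} ∂^α`. -/
def Dmulti (α : Fin n → ℕ) (f : En n → ℂ) : En n → ℂ :=
  fun x => (-Complex.I) ^ (∑ i, α i) * mpderiv α f x

/-- Fourier transform, convention `û(ξ) = ∫ e^{-i⟨x,ξ⟩} u(x) dx`. -/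
def FTn (f : En n → ℂ) : En n → ℂ :=
  fun ξ => ∫ x : En n, Complex.exp (-Complex.I * ((∑ i, x i * ξ i : ℝ) : ℂ)) * f x

/-- The monomial `x^β`. -/
def xpow (β : Fin n → ℕ) (x : En n) : ℝ := ∏ i, x i ^ β i

/-- Condition (1): `u` and `û` are `O(e^{-λω})` together with all derivatives. -/
def Cond1 (ω : ℝ → ℝ) (u : 𝓢(En n, ℂ)) : Prop :=
  (∀ lam > (0 : ℝ), ∀ α : Fin n → ℕ, ∃ C : ℝ,
    ∀ x, Real.exp (lam * ω ‖x‖) * ‖Dmulti α ⇑u x‖ ≤ C) ∧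
  (∀ lam > (0 : ℝ), ∀ α : Fin n → ℕ, ∃ C : ℝ,
    ∀ ξ, Real.exp (lam * ω ‖ξ‖) * ‖Dmulti α (FTn ⇑u) ξ‖ ≤ C)

/-- `B` bounds `t ^ m * exp (-lam * ω t)` on `[1, ∞)`. -/
def Majorizes (ω : ℝ → ℝ) (lam : ℝ) (m : ℕ) (B : ℝ) : Prop :=
  ∀ t, 1 ≤ t → t ^ m * Real.exp (-lam * ω t) ≤ B

lemma Majorizes.pos {ω : ℝ → ℝ} {lam : ℝ} {m : ℕ} {B : ℝ} (h : Majorizes ω lam m B) : 0 < B :=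
  lt_of_lt_of_le (by positivity) (h 1 le_rfl)

lemma Majorizes.anti {ω : ℝ → ℝ} {lam : ℝ} {m k : ℕ} {B : ℝ} (h : Majorizes ω lam m B)
    (hk : k ≤ m) : Majorizes ω lam k B := fun t ht =>
  le_trans (mul_le_mul_of_nonneg_right (pow_le_pow_right₀ ht hk) (Real.exp_nonneg _)) (h t ht)

lemma exp_mul_log_sub {ω : ℝ → ℝ} {lam : ℝ} {m : ℕ} {t : ℝ} (ht : 0 < t) :
    Real.exp (m * Real.log t - lam * ω (Real.exp (Real.log t))) =
      t ^ m * Real.exp (-lam * ω t) := by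
  rw [Real.exp_log ht, sub_eq_add_neg, Real.exp_add, mul_comm (m : ℝ), Real.exp_mul,
    Real.exp_log ht, Real.rpow_natCast, neg_mul]

lemma ofReal_le_mul_expPhiStar_iff {ω : ℝ → ℝ} {lam C a : ℝ} {m : ℕ} (hC : 0 < C) :
    ENNReal.ofReal a ≤ ENNReal.ofReal C * expPhiStar ω lam m ↔
      ∀ B, Majorizes ω lam m B → a ≤ C * B := by
  constructor
  · intro h B hB
    have h1 : expPhiStar ω lam m ≤ ENNReal.ofReal B := by
      refine iSup_le fun s => ENNReal.ofReal_le_ofReal ?_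
      have := hB (Real.exp s) (Real.one_le_exp s.2)
      rw [← exp_mul_log_sub (Real.exp_pos _), Real.log_exp] at this
      exact this
    have h2 := h.trans (mul_le_mul_right h1 _)
    rw [← ENNReal.ofReal_mul hC.le] at h2
    exact (ENNReal.ofReal_le_ofReal_iff (mul_pos hC hB.pos).le).1 h2
  · intro h
    by_cases htop : expPhiStar ω lam m = ⊤
    · rw [htop, ENNReal.mul_top (by simpa using hC)]
      exact le_top
    · rw [← ENNReal.ofReal_toReal htop, ← ENNReal.ofReal_mul hC.le]
      refine ENNReal.ofReal_le_ofReal (h _ fun t ht => ?_)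
      rw [← exp_mul_log_sub (by linarith)]
      refine (ENNReal.ofReal_le_iff_le_toReal htop).1 ?_
      exact le_iSup (fun s : Set.Ici (0 : ℝ) =>
        ENNReal.ofReal (Real.exp (m * s - lam * ω (Real.exp s)))) ⟨Real.log t, Real.log_nonneg ht⟩

namespace IsWeightFn

variable {ω : ℝ → ℝ}

lemma exists_dilate_le (hω : IsWeightFn ω) (K : ℝ) (hK : 1 ≤ K) :
    ∃ L > 0, ∀ t, 0 ≤ t → ω (K * t) ≤ L * (ω t + 1) := by
  obtain ⟨L, hL, h⟩ := hω.alpha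
  have key : ∀ j : ℕ, ∃ M > 0, ∀ t, 0 ≤ t → ω (2 ^ j * t) ≤ M * (ω t + 1) := by
    intro j
    induction j with
    | zero => exact ⟨1, one_pos, fun t ht => by simp⟩
    | succ j ih =>
      obtain ⟨M, hM, ih⟩ := ih
      refine ⟨L * (M + 1), by positivity, fun t ht => ?_⟩
      have h1 := h (2 ^ j * t) (by positivity)
      have h2 := ih t ht
      have h3 := hω.nonneg t ht
      rw [show (2 : ℝ) ^ (j + 1) * t = 2 * (2 ^ j * t) by ring]
      calc _ ≤ _ := h1
        _ ≤ L * (M * (ω t + 1) + 1) := by gcongr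
        _ ≤ L * ((M + 1) * (ω t + 1)) := by gcongr; nlinarith
        _ = _ := by ring
  obtain ⟨j, hj⟩ := pow_unbounded_of_one_lt K (one_lt_two)
  obtain ⟨M, hM, hM'⟩ := key j
  refine ⟨M, hM, fun t ht => le_trans (hω.mono ?_ ?_ ?_) (hM' t ht)⟩
  · exact mul_nonneg (by linarith) ht
  · exact mul_nonneg (by positivity) ht
  · gcongr

lemma exists_pow_le (hω : IsWeightFn ω) : ∃ a : ℝ, ∃ b > 0, ∀ (m : ℕ) (t : ℝ), 0 ≤ t →
    t ^ m ≤ Real.exp (m * ((ω t - a) / b)) := by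
  obtain ⟨a, b, hb, h⟩ := hω.gamma
  refine ⟨a, b, hb, fun m t ht => ?_⟩
  rw [Real.exp_nat_mul]
  refine pow_le_pow_left₀ ht ?_ _
  have h1 : Real.log (1 + t) ≤ (ω t - a) / b := by
    rw [le_div_iff₀ hb]; linarith [h t ht]
  calc t ≤ 1 + t := by linarith
    _ = Real.exp (Real.log (1 + t)) := (Real.exp_log (by linarith)).symm
    _ ≤ _ := Real.exp_le_exp.2 h1

lemma exists_absorb (hω : IsWeightFn ω) (K : ℝ) (hK : 1 ≤ K) (m₀ : ℕ) (lam : ℝ) (hlam : 0 < lam) :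
    ∃ μ > 0, ∃ C > 0, ∀ m B, Majorizes ω lam m B → Majorizes ω μ (m + m₀) (C * B / K ^ m) := by
  obtain ⟨L, hL, hd⟩ := hω.exists_dilate_le K hK
  obtain ⟨a, b, hb, hp⟩ := hω.exists_pow_le
  refine ⟨lam * L + m₀ / b, by positivity, Real.exp (lam * L - m₀ * (a / b)), Real.exp_pos _,
    fun m B hB t ht => ?_⟩
  have hK0 : 0 < K := by linarith
  have ht0 : 0 ≤ t := by linarith
  rw [le_div_iff₀ (by positivity)]
  have h1 := hB (K * t) (by nlinarith)
  have h2 := hd t ht0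
  have h3 := hp m₀ t ht0
  calc t ^ (m + m₀) * Real.exp (-(lam * L + m₀ / b) * ω t) * K ^ m
      = (K * t) ^ m * (t ^ m₀ * Real.exp (-(lam * L + m₀ / b) * ω t)) := by ring
    _ ≤ (K * t) ^ m * (Real.exp (m₀ * ((ω t - a) / b)) *
          Real.exp (-(lam * L + m₀ / b) * ω t)) := by gcongr
    _ = (K * t) ^ m * (Real.exp (lam * L - m₀ * (a / b)) * Real.exp (-lam * (L * (ω t + 1)))) := by
        rw [← Real.exp_add, ← Real.exp_add]; congr 2; field_simp; ring
    _ ≤ (K * t) ^ m * (Real.exp (lam * L - m₀ * (a / b)) * Real.exp (-lam * ω (K * t))) := by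
        have : -lam * (L * (ω t + 1)) ≤ -lam * ω (K * t) := by nlinarith
        gcongr
    _ = Real.exp (lam * L - m₀ * (a / b)) * ((K * t) ^ m * Real.exp (-lam * ω (K * t))) := by ring
    _ ≤ _ := by gcongr

lemma exists_le_linear (hω : IsWeightFn ω) : ∃ D ≥ 0, ∀ t, 1 ≤ t → ω t ≤ D * t := by
  refine ⟨∫ t in Set.Ici (1 : ℝ), ω t / t ^ 2, ?_, fun t ht => ?_⟩
  · refine setIntegral_nonneg measurableSet_Ici fun t (ht : 1 ≤ t) => ?_
    have := hω.nonneg t (by linarith)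
    positivity
  have ht0 : 0 < t := by linarith
  have hsub : Set.Ioi t ⊆ Set.Ici 1 := fun s (hs : t < s) => by
    simp only [Set.mem_Ici]; linarith
  have h1 : ∫ s in Set.Ioi t, ω t * s ^ (-2 : ℝ) ≤ ∫ s in Set.Ioi t, ω s / s ^ 2 := by
    refine setIntegral_mono_on ?_ (hω.beta.mono_set hsub) measurableSet_Ioi ?_
    · exact (integrableOn_Ioi_rpow_of_lt (by norm_num) ht0).const_mul _
    · intro s (hs : t < s)
      have hs0 : 0 < s := by linarith
      rw [Real.rpow_neg hs0.le, div_eq_mul_inv]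
      norm_cast
      gcongr
      exact hω.mono ht0.le hs0.le hs.le
  have h2 : ∫ s in Set.Ioi t, ω s / s ^ 2 ≤ ∫ s in Set.Ici (1 : ℝ), ω s / s ^ 2 := by
    refine setIntegral_mono_set hω.beta ?_ hsub.eventuallyLE
    refine (ae_restrict_iff' measurableSet_Ici).2 (Filter.Eventually.of_forall ?_)
    intro s (hs : 1 ≤ s)
    have := hω.nonneg s (by linarith)
    simp only [Pi.zero_apply]
    positivity
  rw [integral_const_mul, integral_Ioi_rpow_of_lt (by norm_num) ht0] at h1
  have h3 : ω t * (-t ^ ((-2 : ℝ) + 1) / (-2 + 1)) = ω t / t := by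
    rw [show (-2 : ℝ) + 1 = -1 by norm_num, Real.rpow_neg_one]; field_simp
  rw [h3] at h1
  rw [← div_le_iff₀ ht0]
  linarith

lemma exists_sqrt_pow_le (hω : IsWeightFn ω) (μ : ℝ) (hμ : 0 < μ) :
    ∃ C > 0, ∀ p B, 1 ≤ p → Majorizes ω μ p B → √(2 * p) ^ p ≤ C * B := by
  obtain ⟨D, hD, h⟩ := hω.exists_le_linear
  set E := μ * D * Real.exp 1 with hE
  refine ⟨Real.exp (E ^ 2 / 2), Real.exp_pos _, fun p B hp hB => ?_⟩
  have hp' : (1 : ℝ) ≤ p := by exact_mod_cast hp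
  set r := √(2 * p) with hr
  have hr2 : r ^ 2 = 2 * p := Real.sq_sqrt (by positivity)
  have hr1 : 1 ≤ r := by
    rw [hr]; exact Real.one_le_sqrt.2 (by linarith)
  have he : 1 ≤ Real.exp 1 := Real.one_le_exp zero_le_one
  have ht : 1 ≤ Real.exp 1 * r := by nlinarith
  have h1 := hB _ ht
  have h2 := h _ ht
  calc r ^ p
      ≤ r ^ p * (Real.exp (E ^ 2 / 2) * Real.exp p *
          Real.exp (-μ * (D * (Real.exp 1 * r)))) := by
        refine le_mul_of_one_le_right (by positivity) ?_
        rw [← Real.exp_add, ← Real.exp_add]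
        refine Real.one_le_exp ?_
        rw [show -μ * (D * (Real.exp 1 * r)) = - (E * r) by rw [hE]; ring]
        nlinarith [sq_nonneg (E - r)]
    _ ≤ r ^ p * (Real.exp (E ^ 2 / 2) * Real.exp p * Real.exp (-μ * ω (Real.exp 1 * r))) := by
        have : -μ * (D * (Real.exp 1 * r)) ≤ -μ * ω (Real.exp 1 * r) := by nlinarith
        gcongr
    _ = Real.exp (E ^ 2 / 2) * ((Real.exp 1 * r) ^ p * Real.exp (-μ * ω (Real.exp 1 * r))) := by
        rw [mul_pow, show Real.exp (p : ℝ) = Real.exp 1 ^ p by rw [← Real.exp_nat_mul, mul_one]]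
        ring
    _ ≤ _ := by gcongr

/-- Young duality with integer orders. -/
lemma exists_majorizes_pow_succ (hω : IsWeightFn ω) (lam : ℝ) (hlam : 0 < lam) (t : ℝ)
    (ht : 1 ≤ t) :
    ∃ k : ℕ, Majorizes ω lam k (t ^ (k + 1) * Real.exp (-lam * ω t)) := by
  rcases ht.eq_or_lt with rfl | ht
  · refine ⟨0, fun s hs => ?_⟩
    have := hω.mono (a := 1) (b := s) (by simp) (by simp; linarith) hs
    simp only [pow_zero, one_mul, one_pow, Real.exp_le_exp]
    nlinarith
  set φ : ℝ → ℝ := fun s => ω (Real.exp s) with hφ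
  set s₀ := Real.log t with hs₀
  have hs0 : 0 < s₀ := Real.log_pos ht
  have ht0 : 0 < t := by linarith
  obtain ⟨q, hq0, hq⟩ : ∃ q, 0 ≤ q ∧ ∀ s, 0 ≤ s → φ s₀ + q * (s - s₀) ≤ φ s := by
    have hInt : s₀ ∈ interior (Set.Ici (0 : ℝ)) := by simpa using hs0
    have hleft : ∀ s, 0 ≤ s → s < s₀ → slope φ s s₀ ≤ derivWithin φ (Set.Ioi s₀) s₀ :=
      fun s hs hlt =>
      (hω.delta.slope_le_leftDeriv_of_mem_interior hs hInt hlt).trans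
        (hω.delta.leftDeriv_le_rightDeriv_of_mem_interior hInt)
    refine ⟨derivWithin φ (Set.Ioi s₀) s₀, le_trans ?_ (hleft 0 le_rfl hs0), fun s hs => ?_⟩
    · rw [slope_def_field]
      refine div_nonneg (sub_nonneg.2 ?_) (by linarith)
      exact hω.mono (Real.exp_nonneg _) (Real.exp_nonneg _) (Real.exp_le_exp.2 hs0.le)
    · rcases lt_trichotomy s s₀ with h | rfl | h
      · have h1 := hleft s hs h
        rw [slope_def_field, div_le_iff₀ (by linarith)] at h1
        linarith
      · simp
      · have h1 : _ ≤ slope φ s₀ s := hω.delta.rightDeriv_le_slope_of_mem_interior hInt hs h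
        rw [slope_def_field, le_div_iff₀ (by linarith)] at h1
        linarith
  set k := ⌊lam * q⌋₊
  have hk1 : (k : ℝ) ≤ lam * q := Nat.floor_le (by positivity)
  have hk2 : lam * q < k + 1 := Nat.lt_floor_add_one _
  refine ⟨k, fun x hx => ?_⟩
  have hx0 : 0 < x := by linarith
  have h1 := hq (Real.log x) (Real.log_nonneg hx)
  have hlx := Real.log_nonneg hx
  have e1 : φ s₀ = ω t := by simp only [hφ, hs₀, Real.exp_log ht0]
  rw [e1] at h1
  rw [← exp_mul_log_sub hx0, pow_succ, mul_assoc, mul_comm t, ← mul_assoc,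
    ← exp_mul_log_sub ht0]
  nth_rw 3 [← Real.exp_log ht0]
  rw [← Real.exp_add, Real.exp_le_exp, ← hs₀]
  have e2 : ω (Real.exp s₀) = ω t := e1
  rw [e2]
  change k * Real.log x - lam * φ (Real.log x) ≤ _
  nlinarith [mul_le_mul_of_nonneg_left h1 hlam.le, mul_nonneg (sub_nonneg.2 hk1) hlx]

lemma exists_exp_le_of_pow_le (hω : IsWeightFn ω) (K : ℝ) (hK : 1 ≤ K) (m₀ : ℕ) (lam : ℝ)
    (hlam : 0 < lam) :
    ∃ μ > 0, ∃ C > 0, ∀ t A f, 1 ≤ t → 0 ≤ A →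
      (∀ k B, Majorizes ω μ (k + m₀) B → f * t ^ k ≤ A * K ^ k * B) →
      Real.exp (lam * ω t) * f ≤ C * A := by
  obtain ⟨a, b, hb, hp⟩ := hω.exists_pow_le
  obtain ⟨μ, hμ, C, hC, h⟩ := hω.exists_absorb K hK m₀ (lam + 1 / b) (by positivity)
  refine ⟨μ, hμ, C * Real.exp (-a / b), by positivity, fun t A f ht hA hf => ?_⟩
  obtain ⟨k, hk⟩ := hω.exists_majorizes_pow_succ (lam + 1 / b) (by positivity) t ht
  have ht0 : 0 < t := by linarith
  have hK0 : 0 < K := by linarith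
  have h1 := hf k _ (h k _ hk)
  have h2 : f ≤ A * C * (t * Real.exp (-(lam + 1 / b) * ω t)) := by
    refine le_of_mul_le_mul_right (h1.trans (le_of_eq ?_)) (pow_pos ht0 k)
    field_simp
    ring
  have h3 : t ≤ Real.exp ((ω t - a) / b) := by simpa using hp 1 t ht0.le
  calc Real.exp (lam * ω t) * f
      ≤ Real.exp (lam * ω t) * (A * C * (Real.exp ((ω t - a) / b) *
          Real.exp (-(lam + 1 / b) * ω t))) := by
        refine mul_le_mul_of_nonneg_left (h2.trans ?_) (Real.exp_nonneg _)
        gcongr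
    _ = A * C * (Real.exp (lam * ω t) * (Real.exp ((ω t - a) / b) *
          Real.exp (-(lam + 1 / b) * ω t))) := by ring
    _ = A * C * Real.exp (-a / b) := by
        rw [← Real.exp_add, ← Real.exp_add]; congr 2; field_simp; ring
    _ = _ := by ring

end IsWeightFn

open LineDeriv FourierTransform

/-- Multiplication of a Schwartz function by the coordinate `x i`. -/
def coordMul (i : Fin n) (f : 𝓢(En n, ℂ)) : 𝓢(En n, ℂ) :=
  SchwartzMap.smulLeftCLM ℂ (fun x : En n => x i) f

/-- The partial derivative `∂ᵢ` on Schwartz functions. -/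
def partialD (i : Fin n) (f : 𝓢(En n, ℂ)) : 𝓢(En n, ℂ) :=
  ∂_{(EuclideanSpace.single i (1 : ℝ) : En n)} f

/-- Multiplication by the product of the coordinates listed in `l`. -/
def coordWord (l : List (Fin n)) (f : 𝓢(En n, ℂ)) : 𝓢(En n, ℂ) := l.foldr coordMul f

/-- Composition of the partial derivatives listed in `l`. -/
def partialWord (l : List (Fin n)) (f : 𝓢(En n, ℂ)) : 𝓢(En n, ℂ) := l.foldr partialD f

lemma hasTemperateGrowth_coord (i : Fin n) :
    Function.HasTemperateGrowth (fun x : En n => x i) :=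
  (EuclideanSpace.proj i : En n →L[ℝ] ℝ).hasTemperateGrowth

lemma coordMul_apply (i : Fin n) (f : 𝓢(En n, ℂ)) (x : En n) :
    coordMul i f x = (x i : ℂ) * f x := by
  simp [coordMul, SchwartzMap.smulLeftCLM_apply_apply (hasTemperateGrowth_coord i)]

lemma partialD_apply (i : Fin n) (f : 𝓢(En n, ℂ)) (x : En n) :
    partialD i f x = fderiv ℝ f x (EuclideanSpace.single i 1) := rfl

lemma coordMul_add (i : Fin n) (f g : 𝓢(En n, ℂ)) :
    coordMul i (f + g) = coordMul i f + coordMul i g := map_add _ _ _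

lemma partialD_add (i : Fin n) (f g : 𝓢(En n, ℂ)) :
    partialD i (f + g) = partialD i f + partialD i g := lineDerivOp_add _ _ _

lemma coordMul_smul (i : Fin n) (c : ℂ) (f : 𝓢(En n, ℂ)) :
    coordMul i (c • f) = c • coordMul i f := by
  ext x; simp [coordMul_apply, mul_left_comm]

lemma partialD_smul (i : Fin n) (c : ℂ) (f : 𝓢(En n, ℂ)) :
    partialD i (c • f) = c • partialD i f := lineDerivOp_smul _ _ _

lemma partialD_coordMul (i j : Fin n) (f : 𝓢(En n, ℂ)) :
    partialD i (coordMul j f) = coordMul j (partialD i f) + if i = j then f else 0 := by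
  ext x
  have h1 : HasFDerivAt (fun x : En n => x j) (EuclideanSpace.proj j : En n →L[ℝ] ℝ) x :=
    (EuclideanSpace.proj j : En n →L[ℝ] ℝ).hasFDerivAt
  have h2 := h1.smul (f.hasFDerivAt x)
  have h3 : ⇑(coordMul j f) = (fun x : En n => x j) • ⇑f := by
    ext x; simp [coordMul_apply]
  rw [partialD_apply, h3, h2.fderiv]
  by_cases hij : i = j
  · subst hij; simp [coordMul_apply, partialD_apply]
  · simp [coordMul_apply, partialD_apply, hij, Ne.symm hij]

@[simp] lemma coordWord_nil (f : 𝓢(En n, ℂ)) : coordWord [] f = f := rfl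
@[simp] lemma partialWord_nil (f : 𝓢(En n, ℂ)) : partialWord [] f = f := rfl

lemma coordWord_cons (i : Fin n) (l : List (Fin n)) (f : 𝓢(En n, ℂ)) :
    coordWord (i :: l) f = coordMul i (coordWord l f) := rfl

lemma partialWord_cons (i : Fin n) (l : List (Fin n)) (f : 𝓢(En n, ℂ)) :
    partialWord (i :: l) f = partialD i (partialWord l f) := rfl

lemma coordWord_append (l l' : List (Fin n)) (f : 𝓢(En n, ℂ)) :
    coordWord (l ++ l') f = coordWord l (coordWord l' f) := List.foldr_append

lemma partialWord_append (l l' : List (Fin n)) (f : 𝓢(En n, ℂ)) :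
    partialWord (l ++ l') f = partialWord l (partialWord l' f) := List.foldr_append

lemma coordWord_apply (l : List (Fin n)) (f : 𝓢(En n, ℂ)) (x : En n) :
    coordWord l f x = ((l.map x).prod : ℝ) * f x := by
  induction l with
  | nil => simp
  | cons i l ih => simp [coordWord_cons, coordMul_apply, ih, mul_assoc]

lemma coordWord_replicate_apply (k : ℕ) (i : Fin n) (f : 𝓢(En n, ℂ)) (x : En n) :
    coordWord (List.replicate k i) f x = ((x i ^ k : ℝ) : ℂ) * f x := by
  simp [coordWord_apply]

lemma abs_prod_map_le (l : List (Fin n)) (x : En n) : |(l.map x).prod| ≤ ‖x‖ ^ l.length := by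
  induction l with
  | nil => simp
  | cons i l ih =>
    rw [List.map_cons, List.prod_cons, abs_mul, List.length_cons, pow_succ']
    exact mul_le_mul (PiLp.norm_apply_le x i) ih (abs_nonneg _) (norm_nonneg _)

lemma norm_coordWord_apply_le (l : List (Fin n)) (f : 𝓢(En n, ℂ)) (x : En n) :
    ‖coordWord l f x‖ ≤ ‖x‖ ^ l.length * ‖f x‖ := by
  rw [coordWord_apply, norm_mul, Complex.norm_real]
  exact mul_le_mul_of_nonneg_right (abs_prod_map_le l x) (norm_nonneg _)

lemma coordWord_smul (l : List (Fin n)) (c : ℂ) (f : 𝓢(En n, ℂ)) :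
    coordWord l (c • f) = c • coordWord l f := by
  induction l with
  | nil => rfl
  | cons i l ih => rw [coordWord_cons, ih, coordMul_smul, coordWord_cons]

lemma partialWord_smul (l : List (Fin n)) (c : ℂ) (f : 𝓢(En n, ℂ)) :
    partialWord l (c • f) = c • partialWord l f := by
  induction l with
  | nil => rfl
  | cons i l ih => rw [partialWord_cons, ih, partialD_smul, partialWord_cons]

lemma partialWord_add (l : List (Fin n)) (f g : 𝓢(En n, ℂ)) :
    partialWord l (f + g) = partialWord l f + partialWord l g := by
  induction l with
  | nil => rfl
  | cons i l ih => rw [partialWord_cons, ih, partialD_add, partialWord_cons, partialWord_cons]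

lemma coordWord_add (l : List (Fin n)) (f g : 𝓢(En n, ℂ)) :
    coordWord l (f + g) = coordWord l f + coordWord l g := by
  induction l with
  | nil => rfl
  | cons i l ih => rw [coordWord_cons, ih, coordMul_add, coordWord_cons, coordWord_cons]

/-- Commuting one derivative past a monomial of length `s` costs at most `s` monomials of
length `s - 1`. -/
lemma exists_partialD_coordWord (i : Fin n) (l : List (Fin n)) :
    ∃ L : List (List (Fin n)), L.length ≤ l.length ∧ (∀ l' ∈ L, l'.length + 1 = l.length) ∧
      ∀ f, partialD i (coordWord l f) =
        coordWord l (partialD i f) + (L.map fun l' => coordWord l' f).sum := by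
  induction l with
  | nil => exact ⟨[], by simp⟩
  | cons j l ih =>
    obtain ⟨L, h1, h2, h3⟩ := ih
    have hsum : ∀ f, coordMul j (L.map fun l' => coordWord l' f).sum =
        ((L.map (List.cons j)).map fun l' => coordWord l' f).sum := by
      intro f
      clear h1 h2 h3
      induction L with
      | nil => simp [coordMul]
      | cons a L ih => simp [coordMul_add, ih, coordWord_cons]
    by_cases hij : i = j
    · refine ⟨l :: L.map (List.cons j), by simpa using h1, by simpa using h2, fun f => ?_⟩
      rw [coordWord_cons, partialD_coordMul, h3, coordMul_add, hsum, if_pos hij, List.map_cons,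
        List.sum_cons, coordWord_cons]
      abel
    · refine ⟨L.map (List.cons j), by simpa using h1.trans (Nat.le_succ _), by simpa using h2,
        fun f => ?_⟩
      rw [coordWord_cons, partialD_coordMul, h3, coordMul_add, hsum, if_neg hij, add_zero,
        coordWord_cons]

lemma partialWord_replicate_succ_coordMul (k : ℕ) (i j : Fin n) (f : 𝓢(En n, ℂ)) :
    partialWord (List.replicate (k + 1) i) (coordMul j f) =
      coordMul j (partialWord (List.replicate (k + 1) i) f) +
        if i = j then ((k + 1 : ℕ) : ℂ) • partialWord (List.replicate k i) f else 0 := by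
  induction k with
  | zero =>
    simp [partialWord_cons, partialD_coordMul]
  | succ k ih =>
    rw [List.replicate_succ, partialWord_cons, ih, partialD_add, partialD_coordMul,
      partialWord_cons]
    by_cases hij : i = j
    · simp only [hij, if_true, partialD_smul]
      rw [List.replicate_succ, partialWord_cons, add_assoc]
      congr 1
      push_cast
      module
    · simp only [hij, if_false, add_zero]
      rw [show partialD i (0 : 𝓢(En n, ℂ)) = 0 from lineDerivOp_zero _, add_zero]

/-- Dilation by `(2π)⁻¹`. -/
def dilation (n : ℕ) : En n ≃L[ℝ] En n :=
  ContinuousLinearEquiv.smulLeft (Units.mk0 ((2 * π)⁻¹ : ℝ) (by positivity))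

lemma dilation_apply (x : En n) : dilation n x = (2 * π)⁻¹ • x := rfl

/-- The Fourier transform `∫ e^{-i⟨x,ξ⟩} f x` on Schwartz functions. -/
def angularFT (f : 𝓢(En n, ℂ)) : 𝓢(En n, ℂ) :=
  SchwartzMap.compCLMOfContinuousLinearEquiv ℂ (dilation n) (𝓕 f)

lemma angularFT_apply (f : 𝓢(En n, ℂ)) (ξ : En n) :
    angularFT f ξ = 𝓕 f ((2 * π)⁻¹ • ξ) := rfl

lemma angularFT_smul (c : ℂ) (f : 𝓢(En n, ℂ)) : angularFT (c • f) = c • angularFT f := by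
  rw [angularFT, FourierTransform.fourier_smul, map_smul]; rfl

lemma FTn_eq_angularFT (f : 𝓢(En n, ℂ)) : FTn ⇑f = ⇑(angularFT f) := by
  ext ξ
  rw [angularFT_apply, SchwartzMap.fourier_coe, Real.fourier_eq', FTn]
  refine integral_congr_ae (Filter.Eventually.of_forall fun x => ?_)
  simp only [smul_eq_mul]
  congr 2
  rw [real_inner_smul_right, PiLp.inner_apply]
  have : (-2 * π * ((2 * π)⁻¹ * ∑ i, inner ℝ (x i) (ξ i))) = - ∑ i, x i * ξ i := by
    rw [show ∑ i, inner ℝ (x i) (ξ i) = ∑ i, x i * ξ i from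
      Finset.sum_congr rfl fun i _ => by simp [mul_comm]]
    field_simp
  rw [this]
  push_cast
  ring

lemma partialD_angularFT (i : Fin n) (f : 𝓢(En n, ℂ)) :
    partialD i (angularFT f) = angularFT ((-Complex.I) • coordMul i f) := by
  rw [partialD, angularFT, SchwartzMap.lineDerivOp_compCLMOfContinuousLinearEquiv, dilation_apply,
    lineDerivOp_left_smul, SchwartzMap.lineDerivOp_fourier_eq, angularFT]
  congr 1
  have : (fun x : En n => inner ℝ x (EuclideanSpace.single i (1 : ℝ))) = fun x => x i := by
    ext x; simp [EuclideanSpace.inner_single_right]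
  rw [this]
  change (2 * π)⁻¹ • 𝓕 (-(2 * π * Complex.I) • coordMul i f) = _
  rw [FourierTransform.fourier_smul, FourierTransform.fourier_smul]
  ext x
  simp
  field_simp

lemma angularFT_partialD (i : Fin n) (f : 𝓢(En n, ℂ)) :
    angularFT (partialD i f) = Complex.I • coordMul i (angularFT f) := by
  ext ξ
  rw [angularFT_apply, partialD, SchwartzMap.fourier_lineDerivOp_eq]
  have : (fun x : En n => inner ℝ x (EuclideanSpace.single i (1 : ℝ))) = fun x => x i := by
    ext x; simp [EuclideanSpace.inner_single_right]
  rw [this]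
  change ((2 * π * Complex.I) • coordMul i (𝓕 f)) _ = _
  simp [coordMul_apply, angularFT_apply]
  field_simp

lemma partialWord_angularFT (l : List (Fin n)) (f : 𝓢(En n, ℂ)) :
    partialWord l (angularFT f) = angularFT ((-Complex.I) ^ l.length • coordWord l f) := by
  induction l with
  | nil => simp
  | cons i l ih =>
    rw [partialWord_cons, ih, partialD_angularFT, coordMul_smul, smul_smul, ← coordWord_cons,
      List.length_cons, pow_succ']

lemma angularFT_partialWord (l : List (Fin n)) (f : 𝓢(En n, ℂ)) :
    angularFT (partialWord l f) = Complex.I ^ l.length • coordWord l (angularFT f) := by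
  induction l with
  | nil => simp
  | cons i l ih =>
    rw [partialWord_cons, angularFT_partialD, ih, coordMul_smul, smul_smul, ← coordWord_cons,
      List.length_cons, pow_succ']

lemma norm_coordWord_angularFT_apply (l : List (Fin n)) (f : 𝓢(En n, ℂ)) (ξ : En n) :
    ‖coordWord l (angularFT f) ξ‖ = ‖angularFT (partialWord l f) ξ‖ := by
  rw [angularFT_partialWord]; simp

lemma norm_angularFT_apply_le (f : 𝓢(En n, ℂ)) (ξ : En n) : ‖angularFT f ξ‖ ≤ ∫ x, ‖f x‖ := by
  rw [angularFT_apply, ← SchwartzMap.norm_toLp_one]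
  exact SchwartzMap.norm_fourier_apply_le_toLp_one f _

lemma exists_norm_apply_le_integral_angularFT (n : ℕ) :
    ∃ C > 0, ∀ (f : 𝓢(En n, ℂ)) x, ‖f x‖ ≤ C * ∫ ξ, ‖angularFT f ξ‖ := by
  refine ⟨((2 * π) ^ n)⁻¹, by positivity, fun f x => ?_⟩
  have h1 : ∫ ξ, ‖angularFT f ξ‖ = (2 * π) ^ n * ∫ ξ, ‖𝓕 f ξ‖ := by
    simp only [angularFT_apply]
    rw [Measure.integral_comp_inv_smul_of_nonneg volume (fun ξ => ‖𝓕 f ξ‖) (by positivity)]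
    simp
  rw [h1, ← mul_assoc, inv_mul_cancel₀ (by positivity), one_mul, ← SchwartzMap.norm_toLp_one]
  have h2 : f x = 𝓕 (𝓕 f) (-x) := by
    conv_lhs => rw [← (show 𝓕⁻ (𝓕 f) = f from FourierTransform.fourierInv_fourier_eq f)]
    rw [SchwartzMap.fourierInv_coe, Real.fourierInv_eq_fourier_neg, SchwartzMap.fourier_coe]
    rfl
  rw [h2]
  exact SchwartzMap.norm_fourier_apply_le_toLp_one _ _

lemma exists_norm_le_mul_abs_apply (x : En n) (hx : 0 < ‖x‖) : ∃ i, ‖x‖ ≤ n * |x i| := by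
  have h1 : ‖x‖ ≤ ∑ i, |x i| := by
    conv_lhs => rw [← (EuclideanSpace.basisFun (Fin n) ℝ).sum_repr x]
    refine (norm_sum_le _ _).trans (le_of_eq (Finset.sum_congr rfl fun i _ => ?_))
    simp [norm_smul]
  by_contra! h
  have hn : (Finset.univ : Finset (Fin n)).Nonempty := by
    by_contra hne
    rw [Finset.not_nonempty_iff_eq_empty] at hne
    rw [hne, Finset.sum_empty] at h1
    linarith
  have h2 : ∑ i : Fin n, n * |x i| < ∑ i : Fin n, ‖x‖ :=
    Finset.sum_lt_sum_of_nonempty hn fun i _ => h i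
  rw [← Finset.mul_sum] at h2
  simp only [Finset.sum_const, Finset.card_univ, Fintype.card_fin, nsmul_eq_mul] at h2
  nlinarith [mul_le_mul_of_nonneg_left h1 (Nat.cast_nonneg (α := ℝ) n)]

lemma exists_one_add_norm_pow_le (n k : ℕ) :
    ∃ c > 0, ∀ x : En n, (1 + ‖x‖) ^ k ≤ c * (1 + ∑ i, |x i| ^ k) := by
  refine ⟨2 ^ k + (2 * n) ^ k, by positivity, fun x => ?_⟩
  have hS : 0 ≤ ∑ i, |x i| ^ k := Finset.sum_nonneg fun i _ => by positivity
  by_cases hx : ‖x‖ ≤ 1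
  · calc (1 + ‖x‖) ^ k ≤ 2 ^ k := pow_le_pow_left₀ (by positivity) (by linarith) _
      _ ≤ (2 ^ k + (2 * n : ℝ) ^ k) * 1 := by
        have : (0 : ℝ) ≤ (2 * n) ^ k := by positivity
        linarith
      _ ≤ _ := by gcongr; linarith
  · push Not at hx
    obtain ⟨i, hi⟩ := exists_norm_le_mul_abs_apply x (by linarith)
    have h3 : |x i| ^ k ≤ ∑ i, |x i| ^ k :=
      Finset.single_le_sum (f := fun i => |x i| ^ k) (fun i _ => by positivity) (Finset.mem_univ i)
    calc (1 + ‖x‖) ^ k ≤ (2 * n * |x i|) ^ k :=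
          pow_le_pow_left₀ (by positivity) (by linarith) _
      _ = (2 * n) ^ k * |x i| ^ k := mul_pow _ _ _
      _ ≤ (2 ^ k + (2 * n) ^ k) * (1 + ∑ i, |x i| ^ k) := by
        gcongr
        · linarith [pow_pos (two_pos (α := ℝ)) k]
        · linarith

/-- An `L¹` bound by weighted sup norms. -/
lemma exists_integral_norm_le_of_norm_le (n : ℕ) :
    ∃ C > 0, ∀ (f : 𝓢(En n, ℂ)) (M : ℝ), (∀ x, ‖f x‖ ≤ M) →
      (∀ i x, ‖coordWord (List.replicate (n + 1) i) f x‖ ≤ M) → ∫ x, ‖f x‖ ≤ C * M := by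
  obtain ⟨c, hc, hW⟩ := exists_one_add_norm_pow_le n (n + 1)
  have hInt : Integrable (fun x : En n => (1 + ‖x‖) ^ (-((n : ℝ) + 1))) :=
    integrable_one_add_norm (by simp)
  have hI : 0 ≤ ∫ x : En n, (1 + ‖x‖) ^ (-((n : ℝ) + 1)) :=
    integral_nonneg fun x => by positivity
  refine ⟨c * (n + 1) * (1 + ∫ x : En n, (1 + ‖x‖) ^ (-((n : ℝ) + 1))), by positivity,
    fun f M h0 h1 => ?_⟩
  have hM : 0 ≤ M := (norm_nonneg _).trans (h0 0)
  have hpt : ∀ x, ‖f x‖ ≤ c * (n + 1) * M * (1 + ‖x‖) ^ (-((n : ℝ) + 1)) := by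
    intro x
    have hp : (0 : ℝ) < 1 + ‖x‖ := by positivity
    rw [Real.rpow_neg hp.le, ← div_eq_mul_inv, le_div_iff₀ (by positivity)]
    norm_cast
    calc ‖f x‖ * (1 + ‖x‖) ^ (n + 1) ≤ ‖f x‖ * (c * (1 + ∑ i, |x i| ^ (n + 1))) := by
          gcongr; exact hW x
      _ = c * (‖f x‖ + ∑ i, ‖coordWord (List.replicate (n + 1) i) f x‖) := by
          simp only [coordWord_replicate_apply, norm_mul, Complex.norm_real, norm_pow,
            Real.norm_eq_abs]
          rw [← Finset.sum_mul]; ring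
      _ ≤ c * (M + ∑ i : Fin n, M) := by gcongr <;> simp_all
      _ = _ := by simp; ring
  calc ∫ x, ‖f x‖ ≤ ∫ x : En n, c * (n + 1) * M * (1 + ‖x‖) ^ (-((n : ℝ) + 1)) :=
        integral_mono f.integrable.norm (hInt.const_mul _) hpt
    _ = c * (n + 1) * M * ∫ x : En n, (1 + ‖x‖) ^ (-((n : ℝ) + 1)) := integral_const_mul _ _
    _ ≤ _ := by
      have : 0 ≤ c * (n + 1) * M := by positivity
      nlinarith

/-- A sup bound by `L¹` norms of derivatives. -/
lemma exists_norm_le_of_integral_norm_le (n : ℕ) :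
    ∃ C > 0, ∀ (f : 𝓢(En n, ℂ)) (M : ℝ), ∫ x, ‖f x‖ ≤ M →
      (∀ i, ∫ x, ‖partialWord (List.replicate (n + 1) i) f x‖ ≤ M) → ∀ x, ‖f x‖ ≤ C * M := by
  obtain ⟨C, hC, h⟩ := exists_norm_apply_le_integral_angularFT n
  obtain ⟨C', hC', h'⟩ := exists_integral_norm_le_of_norm_le n
  refine ⟨C * C', by positivity, fun f M h0 h1 x => ?_⟩
  rw [mul_assoc]
  refine (h f x).trans (mul_le_mul_of_nonneg_left (h' _ _ (fun ξ => ?_) fun i ξ => ?_) hC.le)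
  · exact (norm_angularFT_apply_le f ξ).trans h0
  · rw [norm_coordWord_angularFT_apply]
    exact (norm_angularFT_apply_le _ ξ).trans (h1 i)

lemma integrable_norm_sq (f : 𝓢(En n, ℂ)) : Integrable fun x => ‖f x‖ ^ 2 :=
  (f.memLp 2).integrable_norm_pow (by norm_num)

/-- An `L¹` bound by weighted `L²` norms. -/
lemma exists_integral_norm_le_of_integral_sq_le (n : ℕ) :
    ∃ C > 0, ∀ (f : 𝓢(En n, ℂ)) (R : ℝ), 0 < R → ∫ x, ‖f x‖ ^ 2 ≤ R ^ 2 →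
      (∀ i, ∫ x, ‖coordWord (List.replicate (n + 1) i) f x‖ ^ 2 ≤ R ^ 2) →
      ∫ x, ‖f x‖ ≤ C * R := by
  obtain ⟨c, hc, hW⟩ := exists_one_add_norm_pow_le n ((n + 1) * 2)
  have hInt : Integrable (fun x : En n => (1 + ‖x‖) ^ (-((n : ℝ) + 1))) :=
    integrable_one_add_norm (by simp)
  set I := ∫ x : En n, (1 + ‖x‖) ^ (-((n : ℝ) + 1)) with hIdef
  have hI : 0 ≤ I := integral_nonneg fun x => by positivity
  refine ⟨I + c * (n + 1), by positivity, fun f R hR h0 h1 => ?_⟩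
  have hpt : ∀ x, ‖f x‖ ≤ R * (1 + ‖x‖) ^ (-((n : ℝ) + 1)) +
      c / R * (‖f x‖ ^ 2 + ∑ i, ‖coordWord (List.replicate (n + 1) i) f x‖ ^ 2) := by
    intro x
    have hp : (1 : ℝ) ≤ 1 + ‖x‖ := by simp
    set w := (1 + ‖x‖) ^ (n + 1) with hw
    have hw1 : 1 ≤ w := one_le_pow₀ hp
    have e1 : (1 + ‖x‖) ^ (-((n : ℝ) + 1)) = w⁻¹ := by
      rw [Real.rpow_neg (by positivity)]; norm_cast
    have h2 : w * ‖f x‖ ^ 2 ≤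
        c * (‖f x‖ ^ 2 + ∑ i, ‖coordWord (List.replicate (n + 1) i) f x‖ ^ 2) := by
      calc w * ‖f x‖ ^ 2 ≤ (1 + ‖x‖) ^ ((n + 1) * 2) * ‖f x‖ ^ 2 := by
            rw [pow_mul, ← hw]; gcongr; nlinarith
        _ ≤ c * (1 + ∑ i, |x i| ^ ((n + 1) * 2)) * ‖f x‖ ^ 2 := by gcongr; exact hW x
        _ = _ := by
          simp only [coordWord_replicate_apply, norm_mul, Complex.norm_real, norm_pow,
            Real.norm_eq_abs, mul_pow, ← pow_mul]
          rw [← Finset.sum_mul]; ring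
    rw [e1, div_mul_eq_mul_div, ← div_eq_mul_inv]
    refine le_trans ?_ (add_le_add_right ((div_le_div_iff_of_pos_right hR).2 h2) _)
    have hw0 : 0 < w := by linarith
    rw [div_add_div _ _ hw0.ne' hR.ne', le_div_iff₀ (by positivity)]
    nlinarith [sq_nonneg (R - w * ‖f x‖), sq_nonneg (R + w * ‖f x‖)]
  have hi2 : Integrable fun x =>
      ‖f x‖ ^ 2 + ∑ i, ‖coordWord (List.replicate (n + 1) i) f x‖ ^ 2 :=
    (integrable_norm_sq f).add (integrable_finsetSum _ fun i _ => integrable_norm_sq _)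
  calc ∫ x, ‖f x‖ ≤ ∫ x, (R * (1 + ‖x‖) ^ (-((n : ℝ) + 1)) +
        c / R * (‖f x‖ ^ 2 + ∑ i, ‖coordWord (List.replicate (n + 1) i) f x‖ ^ 2)) :=
        integral_mono f.integrable.norm ((hInt.const_mul _).add (hi2.const_mul _)) hpt
    _ = R * I + c / R * ((∫ x, ‖f x‖ ^ 2) +
          ∑ i, ∫ x, ‖coordWord (List.replicate (n + 1) i) f x‖ ^ 2) := by
        rw [integral_add (hInt.const_mul _) (hi2.const_mul _), integral_const_mul,
          integral_const_mul, integral_add (integrable_norm_sq f)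
            (integrable_finsetSum _ fun i _ => integrable_norm_sq _),
          integral_finsetSum _ fun i _ => integrable_norm_sq _]
    _ ≤ R * I + c / R * (R ^ 2 + ∑ i : Fin n, R ^ 2) := by
        gcongr; exact h1 _
    _ = _ := by simp; field_simp; ring

lemma integral_inner_partialD (i : Fin n) (f g : 𝓢(En n, ℂ)) :
    ∫ x, inner ℝ (partialD i f x) (g x) = -∫ x, inner ℝ (f x) (partialD i g x) := by
  have h : ∫ x, inner ℝ (g x) (partialD i f x) = -∫ x, inner ℝ (partialD i g x) (f x) :=
    SchwartzMap.integral_bilinear_lineDerivOp_right_eq_neg_left g f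
      (innerSL ℝ : ℂ →L[ℝ] ℂ →L[ℝ] ℝ) (EuclideanSpace.single i (1 : ℝ) : En n)
  simpa only [real_inner_comm] using h

lemma integrable_inner (f g : 𝓢(En n, ℂ)) : Integrable fun x => inner ℝ (f x) (g x) := by
  obtain ⟨C, hC⟩ : ∃ C, ∀ x, ‖g x‖ ≤ C := ⟨_, fun x => SchwartzMap.norm_le_seminorm ℝ g x⟩
  refine (f.integrable.norm.const_mul C).mono'
    (f.continuous.inner g.continuous).aestronglyMeasurable
    (Filter.Eventually.of_forall fun x => (norm_inner_le_norm _ _).trans ?_)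
  rw [mul_comm]
  exact mul_le_mul_of_nonneg_right (hC x) (norm_nonneg _)

lemma abs_integral_inner_le (f g : 𝓢(En n, ℂ)) (a b : ℝ) (hf : ∫ x, ‖f x‖ ≤ a)
    (hg : ∀ x, ‖g x‖ ≤ b) : |∫ x, inner ℝ (f x) (g x)| ≤ a * b := by
  have hb : 0 ≤ b := (norm_nonneg _).trans (hg 0)
  refine (norm_integral_le_of_norm_le (f.integrable.norm.mul_const b)
    (Filter.Eventually.of_forall fun x => (norm_inner_le_norm (𝕜 := ℝ) (f x) (g x)).trans
      (mul_le_mul_of_nonneg_left (hg x) (norm_nonneg _)))).trans ?_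
  rw [integral_mul_const]
  exact mul_le_mul_of_nonneg_right hf hb

/-- Integration by parts moves all derivatives of the first factor to the second one. -/
lemma abs_integral_inner_coordWord_partialWord_le (u : 𝓢(En n, ℂ)) (A ρ : ℝ) (hA : 0 ≤ A)
    (hρ : 1 ≤ ρ) (N : ℕ) (hN : N ≤ ρ ^ 2)
    (base : ∀ σ κ : List (Fin n), σ.length + κ.length ≤ N →
      |∫ x, inner ℝ (coordWord σ u x) (partialWord κ u x)| ≤ A * ρ ^ (σ.length + κ.length))
    (τ : List (Fin n)) : ∀ σ κ : List (Fin n), σ.length + τ.length + κ.length ≤ N →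
      |∫ x, inner ℝ (coordWord σ (partialWord τ u) x) (partialWord κ u x)| ≤
        A * 2 ^ τ.length * ρ ^ (σ.length + τ.length + κ.length) := by
  have hρ0 : 0 < ρ := by linarith
  induction τ with
  | nil => simpa using base
  | cons i τ ih =>
    intro σ κ hlen
    rw [List.length_cons] at hlen
    obtain ⟨L, hL1, hL2, hL⟩ := exists_partialD_coordWord i σ
    set T := A * 2 ^ τ.length * ρ ^ (σ.length + (τ.length + 1) + κ.length) with hT
    have hT0 : 0 ≤ T := by positivity
    have hsum : |∫ x, inner ℝ ((L.map fun l' => coordWord l' (partialWord τ u)).sum x)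
        (partialWord κ u x)| * ρ ^ 2 ≤ L.length * T := by
      clear hL hL1
      induction L with
      | nil => simp
      | cons l L ihL =>
        have hl := hL2 l (by simp)
        have h1 := ih l κ (by omega)
        have h2 := ihL fun l' hl' => hL2 l' (by simp [hl'])
        have h3 : |∫ x, inner ℝ (coordWord l (partialWord τ u) x) (partialWord κ u x)| * ρ ^ 2
            ≤ T := by
          refine (mul_le_mul_of_nonneg_right h1 (by positivity)).trans (le_of_eq ?_)
          rw [hT, ← hl]; ring
        simp only [List.map_cons, List.sum_cons, add_apply, inner_add_left]
        rw [integral_add (integrable_inner _ _) (integrable_inner _ _)]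
        refine (mul_le_mul_of_nonneg_right (abs_add_le _ _) (by positivity)).trans ?_
        push_cast [List.length_cons]
        linarith
    have hsum' : |∫ x, inner ℝ ((L.map fun l' => coordWord l' (partialWord τ u)).sum x)
        (partialWord κ u x)| ≤ T := by
      refine le_of_mul_le_mul_right (hsum.trans ?_) (pow_pos hρ0 2)
      rw [mul_comm T]
      refine mul_le_mul_of_nonneg_right (le_trans ?_ hN) hT0
      exact_mod_cast (show L.length ≤ N by omega)
    have hmain := ih σ (i :: κ) (by rw [List.length_cons]; omega)
    have heq : ∫ x, inner ℝ (coordWord σ (partialWord (i :: τ) u) x) (partialWord κ u x) =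
        -(∫ x, inner ℝ (coordWord σ (partialWord τ u) x) (partialWord (i :: κ) u x)) -
        ∫ x, inner ℝ ((L.map fun l' => coordWord l' (partialWord τ u)).sum x)
          (partialWord κ u x) := by
      rw [partialWord_cons i κ, ← integral_inner_partialD, hL, ← partialWord_cons]
      simp only [add_apply, inner_add_left]
      rw [integral_add (integrable_inner _ _) (integrable_inner _ _)]
      ring
    rw [heq, sub_eq_add_neg]
    refine (abs_add_le _ _).trans ?_
    rw [abs_neg, abs_neg]
    have e : A * 2 ^ τ.length * ρ ^ (σ.length + τ.length + (i :: κ).length) = T := by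
      rw [hT, List.length_cons]; ring
    rw [e] at hmain
    have e2 : A * 2 ^ (i :: τ).length * ρ ^ (σ.length + (i :: τ).length + κ.length) = T + T := by
      rw [hT, List.length_cons]; ring
    rw [e2]
    exact add_le_add hmain hsum'

lemma integral_norm_add_le (f g : 𝓢(En n, ℂ)) :
    ∫ x, ‖(f + g) x‖ ≤ (∫ x, ‖f x‖) + ∫ x, ‖g x‖ := by
  rw [← integral_add f.integrable.norm g.integrable.norm]
  exact integral_mono (f + g).integrable.norm (f.integrable.norm.add g.integrable.norm)
    fun x => norm_add_le _ _

/-- Commuting derivatives past monomials in `L¹`. -/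
lemma integral_norm_partialWord_coordWord_le (u : 𝓢(En n, ℂ)) (A ρ : ℝ) (hA : 0 ≤ A)
    (hρ : 1 ≤ ρ) (N : ℕ) (hN : N ≤ ρ ^ 2)
    (base : ∀ σ τ : List (Fin n), σ.length + τ.length ≤ N →
      ∫ x, ‖coordWord σ (partialWord τ u) x‖ ≤ A * 2 ^ τ.length * ρ ^ (σ.length + τ.length))
    (κ : List (Fin n)) : ∀ σ τ : List (Fin n), κ.length + σ.length + τ.length ≤ N →
      ∫ x, ‖partialWord κ (coordWord σ (partialWord τ u)) x‖ ≤
        A * 4 ^ κ.length * 2 ^ τ.length * ρ ^ (κ.length + σ.length + τ.length) := by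
  have hρ0 : 0 < ρ := by linarith
  induction κ using List.reverseRecOn with
  | nil => simpa using base
  | append_singleton κ i ih =>
    intro σ τ hlen
    rw [List.length_append, List.length_singleton] at hlen ⊢
    obtain ⟨L, hL1, hL2, hL⟩ := exists_partialD_coordWord i σ
    set T := A * 4 ^ κ.length * 2 ^ τ.length * ρ ^ (κ.length + 1 + σ.length + τ.length) with hT
    have hT0 : 0 ≤ T := by positivity
    have hsum : (∫ x, ‖partialWord κ (L.map fun l' => coordWord l' (partialWord τ u)).sum x‖)
        * ρ ^ 2 ≤ L.length * T := by
      clear hL hL1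
      induction L with
      | nil =>
        have := partialWord_smul κ 0 (0 : 𝓢(En n, ℂ))
        simp only [zero_smul] at this
        simp [this]
      | cons l L ihL =>
        have hl := hL2 l (by simp)
        have h1 := ih l τ (by omega)
        have h2 := ihL fun l' hl' => hL2 l' (by simp [hl'])
        have h3 : (∫ x, ‖partialWord κ (coordWord l (partialWord τ u)) x‖) * ρ ^ 2 ≤ T := by
          refine (mul_le_mul_of_nonneg_right h1 (by positivity)).trans (le_of_eq ?_)
          rw [hT, ← hl]; ring
        rw [List.map_cons, List.sum_cons, partialWord_add]
        refine (mul_le_mul_of_nonneg_right (integral_norm_add_le _ _) (by positivity)).trans ?_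
        push_cast [List.length_cons]
        linarith
    have hsum' : ∫ x, ‖partialWord κ (L.map fun l' => coordWord l' (partialWord τ u)).sum x‖
        ≤ T := by
      refine le_of_mul_le_mul_right (hsum.trans ?_) (pow_pos hρ0 2)
      rw [mul_comm T]
      refine mul_le_mul_of_nonneg_right (le_trans ?_ hN) hT0
      exact_mod_cast (show L.length ≤ N by omega)
    have hmain := ih σ (i :: τ) (by rw [List.length_cons]; omega)
    rw [partialWord_append, partialWord_cons, partialWord_nil, hL, partialWord_add,
      ← partialWord_cons]
    refine (integral_norm_add_le _ _).trans ?_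
    have e : A * 4 ^ κ.length * 2 ^ (i :: τ).length * ρ ^ (κ.length + σ.length + (i :: τ).length)
        = 2 * T := by
      rw [hT, List.length_cons]; ring
    rw [e] at hmain
    have e2 : A * 4 ^ (κ.length + 1) * 2 ^ τ.length * ρ ^ (κ.length + 1 + σ.length + τ.length)
        = 4 * T := by
      rw [hT]; ring
    rw [e2]
    linarith

/-- Bounds on the moments of `u` and its Fourier transform control all seminorms of `u`. -/
lemma exists_norm_coordWord_partialWord_le (n : ℕ) (D : ℝ) (hD : 0 ≤ D) :
    ∃ C > 0, ∀ (u : 𝓢(En n, ℂ)) (ρ : ℝ) (P : ℕ), 1 ≤ ρ → P ≤ ρ ^ 2 →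
      (∀ k ≤ P, ∀ x, ‖x‖ ^ k * ‖u x‖ ≤ D * ρ ^ k) →
      (∀ k ≤ P, ∀ x, ‖x‖ ^ k * ‖angularFT u x‖ ≤ D * ρ ^ k) →
      ∀ σ τ : List (Fin n), 2 * (σ.length + τ.length) + 5 * (n + 1) ≤ P →
        ∀ x, ‖coordWord σ (partialWord τ u) x‖ ≤
          C * 2 ^ τ.length * ρ ^ (σ.length + τ.length + 3 * (n + 1)) := by
  obtain ⟨C0, hC0, h0⟩ := exists_norm_apply_le_integral_angularFT n
  obtain ⟨C1, hC1, h1⟩ := exists_integral_norm_le_of_norm_le n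
  obtain ⟨C2, hC2, h2⟩ := exists_integral_norm_le_of_integral_sq_le n
  obtain ⟨C3, hC3, h3⟩ := exists_norm_le_of_integral_norm_le n
  set F := (C1 * D) * (C0 * (C1 * D)) with hF
  have hF0 : 0 ≤ F := by positivity
  refine ⟨C3 * (C2 * (1 + F) * 4 ^ (n + 1)), by positivity, fun u ρ P hρ hP hu hv σ τ hlen => ?_⟩
  have hρ0 : 0 < ρ := by linarith
  have moment : ∀ f : 𝓢(En n, ℂ), (∀ k ≤ P, ∀ x, ‖x‖ ^ k * ‖f x‖ ≤ D * ρ ^ k) →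
      ∀ σ : List (Fin n), σ.length + (n + 1) ≤ P →
        ∫ x, ‖coordWord σ f x‖ ≤ C1 * D * ρ ^ (σ.length + (n + 1)) := by
    intro f hf σ hσ
    rw [mul_assoc]
    refine h1 _ _ (fun x => ?_) fun i x => ?_
    · refine ((norm_coordWord_apply_le _ _ _).trans (hf _ (by omega) x)).trans ?_
      gcongr
      omega
    · rw [← coordWord_append]
      refine ((norm_coordWord_apply_le _ _ _).trans (hf _ ?_ x)).trans (le_of_eq ?_)
      · simp; omega
      · simp [add_comm]
  have hsup : ∀ κ : List (Fin n), κ.length + (n + 1) ≤ P → ∀ x,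
      ‖partialWord κ u x‖ ≤ C0 * (C1 * D) * ρ ^ (κ.length + (n + 1)) := by
    intro κ hκ x
    rw [mul_assoc]
    refine (h0 _ x).trans (mul_le_mul_of_nonneg_left ?_ hC0.le)
    simp only [← norm_coordWord_angularFT_apply]
    exact moment _ hv κ hκ
  obtain ⟨N, rfl⟩ : ∃ N, P = N + (n + 1) := ⟨P - (n + 1), by omega⟩
  have hN : (N : ℝ) ≤ ρ ^ 2 := le_trans (by exact_mod_cast Nat.le_add_right _ _) hP
  have hpair := abs_integral_inner_coordWord_partialWord_le u (F * ρ ^ (2 * (n + 1))) ρ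
    (by positivity) hρ N hN fun σ κ hσκ =>
      (abs_integral_inner_le _ _ _ _ (moment u hu σ (by omega)) (hsup κ (by omega))).trans
        (le_of_eq (by rw [hF]; ring))
  have hL2 : ∀ σ τ : List (Fin n), 2 * (σ.length + τ.length) ≤ N →
      ∫ x, ‖coordWord σ (partialWord τ u) x‖ ^ 2 ≤
        F * 2 ^ τ.length * ρ ^ (2 * (σ.length + τ.length + (n + 1))) := by
    intro σ τ hστ
    have h := hpair τ (σ ++ σ) τ (by simp; omega)
    have e : ∀ x, inner ℝ (coordWord (σ ++ σ) (partialWord τ u) x) (partialWord τ u x) =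
        ‖coordWord σ (partialWord τ u) x‖ ^ 2 := by
      intro x
      rw [← real_inner_self_eq_norm_sq, coordWord_apply, coordWord_apply, ← Complex.real_smul,
        ← Complex.real_smul, real_inner_smul_left, real_inner_smul_left, real_inner_smul_right,
        List.map_append, List.prod_append]
      ring
    simp only [e] at h
    refine ((le_abs_self _).trans h).trans (le_of_eq ?_)
    rw [List.length_append]; ring
  have hL1 : ∀ σ τ : List (Fin n), 2 * (σ.length + τ.length + (n + 1)) ≤ N →
      ∫ x, ‖coordWord σ (partialWord τ u) x‖ ≤
        C2 * (1 + F) * ρ ^ (2 * (n + 1)) * 2 ^ τ.length * ρ ^ (σ.length + τ.length) := by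
    intro σ τ hστ
    have key : ∀ m, m ≤ σ.length + τ.length + 2 * (n + 1) → F * 2 ^ τ.length * ρ ^ (2 * m) ≤
        ((1 + F) * 2 ^ τ.length * ρ ^ (σ.length + τ.length + 2 * (n + 1))) ^ 2 := by
      intro m hm
      rw [mul_pow, mul_pow, ← pow_mul ρ, mul_comm _ 2]
      have : (1 : ℝ) ≤ 2 ^ τ.length := one_le_pow₀ one_le_two
      gcongr
      · nlinarith
      · nlinarith
    refine (h2 _ ((1 + F) * 2 ^ τ.length * ρ ^ (σ.length + τ.length + 2 * (n + 1)))
      (by positivity) ?_ fun i => ?_).trans (le_of_eq (by ring))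
    · exact (hL2 σ τ (by omega)).trans (key _ (by omega))
    · rw [← coordWord_append]
      refine (hL2 _ τ (by simp; omega)).trans (key _ ?_)
      simp; omega
  have hcomm := integral_norm_partialWord_coordWord_le u (C2 * (1 + F) * ρ ^ (2 * (n + 1))) ρ
    (by positivity) hρ (σ.length + τ.length + (n + 1))
    (le_trans (by exact_mod_cast (show _ ≤ N by omega)) hN)
    (fun σ' τ' h => hL1 σ' τ' (by omega))
  intro x
  refine (h3 _ (C2 * (1 + F) * 4 ^ (n + 1) * 2 ^ τ.length *
    ρ ^ (σ.length + τ.length + 3 * (n + 1))) ?_ (fun i => ?_) x).trans (le_of_eq (by ring))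
  · refine (hcomm [] σ τ (by simp)).trans ?_
    have : (1 : ℝ) ≤ 4 ^ (n + 1) := one_le_pow₀ (by norm_num)
    calc C2 * (1 + F) * ρ ^ (2 * (n + 1)) * 4 ^ 0 * 2 ^ τ.length * ρ ^ (0 + σ.length + τ.length)
        = C2 * (1 + F) * 1 * 2 ^ τ.length * ρ ^ (σ.length + τ.length + 2 * (n + 1)) := by ring
      _ ≤ _ := by
        gcongr
        omega
  · refine (hcomm (List.replicate (n + 1) i) σ τ (by simp; omega)).trans (le_of_eq ?_)
    rw [List.length_replicate]; ring

/-- The list containing `i` with multiplicity `α i`. -/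
def multiWord (α : Fin n → ℕ) : List (Fin n) :=
  (List.finRange n).flatMap fun i => List.replicate (α i) i

lemma count_multiWord (α : Fin n → ℕ) (i : Fin n) : (multiWord α).count i = α i := by
  simp only [multiWord, List.count_flatMap, Function.comp_def, List.count_replicate, beq_iff_eq]
  rw [← Fin.sum_univ_def]
  simp

lemma length_multiWord (α : Fin n → ℕ) : (multiWord α).length = ∑ i, α i := by
  simp only [multiWord, List.length_flatMap, List.length_replicate]
  rw [← Fin.sum_univ_def]

lemma multiWord_count_perm (σ : List (Fin n)) : (multiWord fun i => σ.count i).Perm σ :=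
  List.perm_iff_count.2 fun i => count_multiWord _ i

lemma multiWord_single (i : Fin n) (k : ℕ) :
    multiWord (Pi.single i k) = List.replicate k i := by
  refine List.perm_replicate.1 (List.perm_iff_count.2 fun j => ?_)
  rw [count_multiWord, List.count_replicate]
  by_cases h : j = i
  · subst h; simp
  · simp [h, Ne.symm h]

lemma xpow_eq_prod_map_multiWord (β : Fin n → ℕ) (x : En n) :
    xpow β x = ((multiWord β).map x).prod := by
  rw [xpow, multiWord, Fin.prod_univ_def]
  induction List.finRange n with
  | nil => rfl
  | cons i l ih => simp [ih]

lemma abs_xpow_mul_norm (β : Fin n → ℕ) (f : 𝓢(En n, ℂ)) (x : En n) :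
    |xpow β x| * ‖f x‖ = ‖coordWord (multiWord β) f x‖ := by
  rw [coordWord_apply, norm_mul, Complex.norm_real, xpow_eq_prod_map_multiWord, Real.norm_eq_abs]

lemma mpderiv_eq_partialWord (α : Fin n → ℕ) (f : 𝓢(En n, ℂ)) :
    mpderiv α ⇑f = ⇑(partialWord (multiWord α) f) := by
  have hrep : ∀ (i : Fin n) (k : ℕ) (g : 𝓢(En n, ℂ)),
      (pderivE i)^[k] ⇑g = ⇑(partialWord (List.replicate k i) g) := by
    intro i k g
    induction k with
    | zero => rfl
    | succ k ih => rw [Function.iterate_succ_apply', ih, List.replicate_succ]; rfl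
  rw [mpderiv, multiWord]
  induction List.finRange n with
  | nil => rfl
  | cons i l ih => rw [List.foldr_cons, ih, hrep, List.flatMap_cons, partialWord_append]

lemma norm_Dmulti_apply (α : Fin n → ℕ) (f : 𝓢(En n, ℂ)) (x : En n) :
    ‖Dmulti α ⇑f x‖ = ‖partialWord (multiWord α) f x‖ := by
  rw [Dmulti, mpderiv_eq_partialWord]; simp

lemma coordWord_apply_of_perm {σ σ' : List (Fin n)} (h : σ.Perm σ') (f : 𝓢(En n, ℂ))
    (x : En n) : coordWord σ f x = coordWord σ' f x := by
  rw [coordWord_apply, coordWord_apply, (h.map x).prod_eq]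

lemma forall_ofReal_le_expPhiStar_iff (ω : ℝ → ℝ) (u : 𝓢(En n, ℂ)) (lam C : ℝ) (hC : 0 < C) :
    (∀ (α β : Fin n → ℕ) (x : En n), ENNReal.ofReal (|xpow β x| * ‖Dmulti α ⇑u x‖) ≤
        ENNReal.ofReal C * expPhiStar ω lam ((∑ i, α i) + ∑ i, β i)) ↔
      ∀ (α : Fin n → ℕ) (σ : List (Fin n)) (x : En n) (B : ℝ),
        Majorizes ω lam (σ.length + (multiWord α).length) B →
          ‖coordWord σ (partialWord (multiWord α) u) x‖ ≤ C * B := by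
  have key : ∀ (α β : Fin n → ℕ) (x : En n),
      ENNReal.ofReal (|xpow β x| * ‖Dmulti α ⇑u x‖) ≤
        ENNReal.ofReal C * expPhiStar ω lam ((∑ i, α i) + ∑ i, β i) ↔
      ∀ B, Majorizes ω lam ((multiWord β).length + (multiWord α).length) B →
        ‖coordWord (multiWord β) (partialWord (multiWord α) u) x‖ ≤ C * B := by
    intro α β x
    rw [← ofReal_le_mul_expPhiStar_iff hC, norm_Dmulti_apply, abs_xpow_mul_norm,
      length_multiWord, length_multiWord]
    push_cast
    rw [add_comm]
  simp only [key]
  refine ⟨fun h α σ x B hB => ?_, fun h α β x B hB => h α _ x B hB⟩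
  have hp := multiWord_count_perm σ
  rw [← coordWord_apply_of_perm hp]
  exact h α _ x B (by rwa [hp.length_eq])

namespace IsWeightFn

variable {ω : ℝ → ℝ}

lemma norm_pow_mul_le (hω : IsWeightFn ω) {μ C R : ℝ} {k : ℕ} (hμ : 0 < μ) (f : En n → ℂ)
    (hf : ∀ x, Real.exp (μ * ω ‖x‖) * ‖f x‖ ≤ C) (hR : Majorizes ω μ k R) (x : En n) :
    ‖x‖ ^ k * ‖f x‖ ≤ C * Real.exp (μ * ω 1) * R := by
  have h1 := hR (max 1 ‖x‖) (le_max_left _ _)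
  have h2 : ω (max 1 ‖x‖) ≤ ω 1 + ω ‖x‖ := by
    have a1 := hω.nonneg 1 zero_le_one
    have a2 := hω.nonneg _ (norm_nonneg x)
    rcases max_choice 1 ‖x‖ with h | h <;> rw [h] <;> linarith
  have hC : 0 ≤ C := le_trans (by positivity) (hf x)
  calc ‖x‖ ^ k * ‖f x‖ ≤ (max 1 ‖x‖) ^ k * ‖f x‖ := by gcongr; exact le_max_right _ _
    _ = (max 1 ‖x‖) ^ k * Real.exp (-μ * (ω 1 + ω ‖x‖)) *
          (Real.exp (μ * ω ‖x‖) * ‖f x‖) * Real.exp (μ * ω 1) := by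
        have : Real.exp (-μ * (ω 1 + ω ‖x‖)) * Real.exp (μ * ω ‖x‖) * Real.exp (μ * ω 1) = 1 := by
          rw [← Real.exp_add, ← Real.exp_add, Real.exp_eq_one_iff]; ring
        linear_combination (-((max 1 ‖x‖) ^ k * ‖f x‖)) * this
    _ ≤ (max 1 ‖x‖) ^ k * Real.exp (-μ * ω (max 1 ‖x‖)) * C * Real.exp (μ * ω 1) := by
        have : -μ * (ω 1 + ω ‖x‖) ≤ -μ * ω (max 1 ‖x‖) := by nlinarith
        gcongr
        exact hf x
    _ ≤ R * C * Real.exp (μ * ω 1) := by gcongr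
    _ = _ := by ring

/-- A geometric majorant of the weighted powers up to order `2 * p`. -/
lemma exists_geometric_majorant (hω : IsWeightFn ω) (μ : ℝ) (hμ : 0 < μ) :
    ∃ C > 0, ∀ p B, 1 ≤ p → Majorizes ω μ p B → ∃ ρ : ℝ, 1 ≤ ρ ∧ ((2 * p : ℕ) : ℝ) ≤ ρ ^ 2 ∧
      (∀ k ≤ 2 * p, Majorizes ω (2 * μ) k (ρ ^ k)) ∧ ρ ^ p ≤ C * B := by
  obtain ⟨C, hC, h⟩ := hω.exists_sqrt_pow_le μ hμ
  refine ⟨max C 1, by positivity, fun p B hp hB => ?_⟩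
  have hp0 : p ≠ 0 := by omega
  have hp' : (1 : ℝ) ≤ p := by exact_mod_cast hp
  have hBp : (B ^ ((p : ℝ)⁻¹)) ^ p = B := Real.rpow_inv_natCast_pow hB.pos.le hp0
  have hr1 : 1 ≤ √(2 * p : ℝ) := Real.one_le_sqrt.2 (by linarith)
  set ρ := max (√(2 * p : ℝ)) (B ^ ((p : ℝ)⁻¹)) with hρ
  have hρ1 : 1 ≤ ρ := hr1.trans (le_max_left _ _)
  have hBρ : B ≤ ρ ^ p := by
    rw [← hBp]
    exact pow_le_pow_left₀ (Real.rpow_nonneg hB.pos.le _) (le_max_right _ _) _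
  refine ⟨ρ, hρ1, ?_, fun k hk t ht => ?_, ?_⟩
  · push_cast
    rw [← Real.sq_sqrt (show (0 : ℝ) ≤ 2 * p by positivity)]
    exact pow_le_pow_left₀ (by positivity) (le_max_left _ _) _
  · have ht0 : 0 < t := by linarith
    have hω0 := hω.nonneg t ht0.le
    have hk' : (k : ℝ) ≤ 2 * p := by exact_mod_cast hk
    refine le_of_pow_le_pow_left₀ hp0 (by positivity) ?_
    calc (t ^ k * Real.exp (-(2 * μ) * ω t)) ^ p
        = (t ^ p) ^ k * Real.exp (p * (-(2 * μ) * ω t)) := by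
          rw [mul_pow, Real.exp_nat_mul]; ring
      _ ≤ (t ^ p) ^ k * Real.exp (k * (-μ * ω t)) := by
          have : p * (-(2 * μ) * ω t) ≤ k * (-μ * ω t) := by
            nlinarith [mul_nonneg hμ.le hω0, mul_nonneg (sub_nonneg.2 hk') (mul_nonneg hμ.le hω0)]
          gcongr
      _ = (t ^ p * Real.exp (-μ * ω t)) ^ k := by rw [mul_pow, Real.exp_nat_mul]
      _ ≤ (ρ ^ p) ^ k := pow_le_pow_left₀ (by positivity) ((hB t ht).trans hBρ) _
      _ = (ρ ^ k) ^ p := by ring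
  · have hB0 := hB.pos
    rcases max_choice (√(2 * p : ℝ)) (B ^ ((p : ℝ)⁻¹)) with h' | h' <;> rw [hρ, h']
    · exact (h p B hp hB).trans (by gcongr; exact le_max_left _ _)
    · rw [hBp]; exact le_mul_of_one_le_left hB0.le (le_max_right _ _)

lemma exists_exp_mul_le_of_abs_pow_le (hω : IsWeightFn ω) (n : ℕ) (K : ℝ) (hK : 1 ≤ K) (m₀ : ℕ)
    (lam : ℝ) (hlam : 0 < lam) :
    ∃ μ > 0, ∃ C > 0, ∀ (x : En n) (A f : ℝ), 0 ≤ A → 0 ≤ f →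
      (∀ B, Majorizes ω μ m₀ B → f ≤ A * B) →
      (∀ i k B, Majorizes ω μ (k + m₀) B → |x i| ^ k * f ≤ A * K ^ k * B) →
      Real.exp (lam * ω ‖x‖) * f ≤ C * A := by
  obtain ⟨μ, hμ, C, hC, h⟩ := hω.exists_exp_le_of_pow_le ((n + 1) * K)
    (by nlinarith [Nat.cast_nonneg (α := ℝ) n]) m₀ lam hlam
  refine ⟨μ, hμ, C, hC, fun x A f hA hf h0 h1 => ?_⟩
  have hω1 : ω ‖x‖ ≤ ω (max 1 ‖x‖) :=
    hω.mono (norm_nonneg x) (le_trans zero_le_one (le_max_left 1 ‖x‖)) (le_max_right _ _)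
  refine le_trans ?_ (h (max 1 ‖x‖) A f (le_max_left _ _) hA fun k B hB => ?_)
  · gcongr
  have hB0 := hB.pos
  rcases le_or_gt ‖x‖ 1 with hx | hx
  · rw [max_eq_left hx, one_pow, mul_one]
    refine (h0 B (hB.anti (Nat.le_add_left _ _))).trans ?_
    have : 1 ≤ ((n + 1) * K) ^ k := one_le_pow₀ (by nlinarith [Nat.cast_nonneg (α := ℝ) n])
    gcongr
    exact le_mul_of_one_le_right hA this
  · rw [max_eq_right hx.le]
    obtain ⟨i, hi⟩ := exists_norm_le_mul_abs_apply x (by linarith)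
    calc f * ‖x‖ ^ k ≤ f * ((n + 1) * |x i|) ^ k := by
          gcongr; nlinarith [abs_nonneg (x i)]
      _ = (n + 1) ^ k * (|x i| ^ k * f) := by rw [mul_pow]; ring
      _ ≤ (n + 1) ^ k * (A * K ^ k * B) :=
        mul_le_mul_of_nonneg_left (h1 i k B hB) (by positivity)
      _ = _ := by rw [mul_pow]; ring

end IsWeightFn

/-- Weighted bounds, geometric in the order, on the pure derivatives of `f`. -/
def PureDerivBound (ω : ℝ → ℝ) (f : 𝓢(En n, ℂ)) : Prop :=
  ∃ K ≥ (1 : ℝ), ∃ m₀ : ℕ, ∀ lam > (0 : ℝ), ∃ C > (0 : ℝ), ∀ i k σ x B,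
    Majorizes ω lam (k + σ.length + m₀) B →
      ‖coordWord σ (partialWord (List.replicate k i) f) x‖ ≤ C * K ^ k * B

lemma PureDerivBound.coordMul {ω : ℝ → ℝ} {f : 𝓢(En n, ℂ)} (h : PureDerivBound ω f) (j : Fin n) :
    PureDerivBound ω (coordMul j f) := by
  obtain ⟨K, hK, m₀, h⟩ := h
  refine ⟨4 * K, by linarith, m₀ + 1, fun lam hlam => ?_⟩
  obtain ⟨C, hC, h⟩ := h lam hlam
  refine ⟨C, hC, fun i k σ x B hB => ?_⟩
  have hB0 := hB.pos
  have h1 : ∀ k, Majorizes ω lam (k + σ.length + (m₀ + 1)) B →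
      ‖coordWord σ (_root_.coordMul j (partialWord (List.replicate k i) f)) x‖
        ≤ C * K ^ k * B := by
    intro k hB
    have := h i k (σ ++ [j]) x B (hB.anti (by simp; omega))
    rwa [coordWord_append] at this
  cases k with
  | zero => simpa using h1 0 hB
  | succ k =>
    rw [partialWord_replicate_succ_coordMul, coordWord_add, add_apply]
    have h2 := h1 (k + 1) hB
    have h3 : ‖coordWord σ (if i = j then ((k + 1 : ℕ) : ℂ) • partialWord (List.replicate k i) f
        else 0) x‖ ≤ (k + 1) * (C * K ^ (k + 1) * B) := by
      have h4 := h i k σ x B (hB.anti (by omega))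
      split_ifs
      · rw [coordWord_smul, smul_apply, norm_smul, Complex.norm_natCast]
        push_cast
        gcongr
        refine h4.trans ?_
        gcongr
        omega
      · rw [coordWord_apply, zero_apply, mul_zero, norm_zero]; positivity
    refine (norm_add_le _ _).trans ((add_le_add h2 h3).trans ?_)
    have h5 : (k : ℝ) + 2 ≤ 4 ^ (k + 1) := by
      have := one_add_mul_le_pow (a := (3 : ℝ)) (by norm_num) (k + 1)
      push_cast at this
      norm_num at this
      linarith [Nat.cast_nonneg (α := ℝ) k]
    calc C * K ^ (k + 1) * B + (k + 1) * (C * K ^ (k + 1) * B)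
        = C * (((k : ℝ) + 2) * K ^ (k + 1)) * B := by ring
      _ ≤ C * (4 ^ (k + 1) * K ^ (k + 1)) * B := by gcongr
      _ = _ := by rw [mul_pow]

lemma PureDerivBound.coordWord {ω : ℝ → ℝ} {f : 𝓢(En n, ℂ)} (h : PureDerivBound ω f)
    (l : List (Fin n)) : PureDerivBound ω (coordWord l f) := by
  induction l with
  | nil => exact h
  | cons i l ih => exact ih.coordMul i

lemma PureDerivBound.exists_exp_mul_norm_angularFT_le {ω : ℝ → ℝ} {f : 𝓢(En n, ℂ)}
    (h : PureDerivBound ω f) (hω : IsWeightFn ω) (lam : ℝ) (hlam : 0 < lam) :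
    ∃ C : ℝ, ∀ ξ, Real.exp (lam * ω ‖ξ‖) * ‖angularFT f ξ‖ ≤ C := by
  rcases isEmpty_or_nonempty (Fin n) with hn | ⟨⟨i₀⟩⟩
  · exact ⟨_, fun ξ => le_of_eq (by rw [Subsingleton.elim ξ 0])⟩
  obtain ⟨K, hK, m₀, h⟩ := h
  obtain ⟨μ, hμ, C, hC, hexp⟩ :=
    hω.exists_exp_mul_le_of_abs_pow_le n K hK (n + 1 + m₀) lam hlam
  obtain ⟨A, hA, h⟩ := h μ hμ
  obtain ⟨C1, hC1, h1⟩ := exists_integral_norm_le_of_norm_le n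
  have hInt : ∀ i k B, Majorizes ω μ (k + (n + 1 + m₀)) B → ∀ ξ,
      ‖angularFT (partialWord (List.replicate k i) f) ξ‖ ≤ C1 * (A * K ^ k * B) := by
    intro i k B hB ξ
    refine (norm_angularFT_apply_le _ _).trans (h1 _ _ (fun x => ?_) fun j x => ?_)
    · exact h i k [] x B (hB.anti (by simp))
    · exact h i k _ x B (hB.anti (by simp; omega))
  refine ⟨C * (C1 * A), fun ξ => hexp ξ (C1 * A) _ (by positivity) (norm_nonneg _)
    (fun B hB => ?_) fun i k B hB => ?_⟩
  · simpa [mul_assoc] using hInt i₀ 0 B (by simpa using hB) ξ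
  · have := hInt i k B hB ξ
    rw [← norm_coordWord_angularFT_apply, coordWord_replicate_apply, norm_mul, Complex.norm_real,
      norm_pow, Real.norm_eq_abs] at this
    exact this.trans (le_of_eq (by ring))

lemma exists_norm_coordWord_partialWord_le_of_cond1 {ω : ℝ → ℝ} {u : 𝓢(En n, ℂ)}
    (h : Cond1 ω u) (hω : IsWeightFn ω) (lam : ℝ) (hlam : 0 < lam) :
    ∃ C > 0, ∀ (τ σ : List (Fin n)) (x : En n) (B : ℝ),
      Majorizes ω lam (σ.length + τ.length) B →
        ‖coordWord σ (partialWord τ u) x‖ ≤ C * B := by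
  have hzero : multiWord (0 : Fin n → ℕ) = [] := by
    rw [← List.length_eq_zero_iff, length_multiWord]; simp
  obtain ⟨μ, hμ, C, hC, habs⟩ := hω.exists_absorb 2 one_le_two (3 * (n + 1)) lam hlam
  obtain ⟨C', hC', hgeo⟩ := hω.exists_geometric_majorant μ hμ
  have hμ2 : 0 < 2 * μ := by positivity
  obtain ⟨D₁, hD₁⟩ := h.1 (2 * μ) hμ2 0
  obtain ⟨D₂, hD₂⟩ := h.2 (2 * μ) hμ2 0
  simp only [norm_Dmulti_apply, hzero, partialWord_nil, FTn_eq_angularFT] at hD₁ hD₂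
  set D := max D₁ D₂ * Real.exp (2 * μ * ω 1) with hD
  have hD0 : 0 ≤ D :=
    mul_nonneg ((le_trans (by positivity) (hD₁ 0)).trans (le_max_left _ _)) (Real.exp_nonneg _)
  obtain ⟨E, hE, hmain⟩ := exists_norm_coordWord_partialWord_le n D hD0
  refine ⟨E * (C' * C), by positivity, fun τ σ x B hB => ?_⟩
  obtain ⟨ρ, hρ, hPρ, hk, hle⟩ := hgeo _ _ (by omega) (habs _ B hB)
  have hB0 := hB.pos
  have h1 := hmain u ρ _ hρ hPρ
    (fun k hkP => hω.norm_pow_mul_le hμ2 _ (fun x => (hD₁ x).trans (le_max_left _ _)) (hk k hkP))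
    (fun k hkP => hω.norm_pow_mul_le hμ2 _ (fun x => (hD₂ x).trans (le_max_right _ _)) (hk k hkP))
    σ τ (by omega) x
  calc _ ≤ E * 2 ^ τ.length * ρ ^ (σ.length + τ.length + 3 * (n + 1)) := h1
    _ ≤ E * 2 ^ (σ.length + τ.length) * (C' * (C * B / 2 ^ (σ.length + τ.length))) := by
      gcongr
      · exact one_le_two
      · omega
    _ = _ := by field_simp

lemma cond1_of_norm_coordWord_partialWord_le {ω : ℝ → ℝ} {u : 𝓢(En n, ℂ)} (hω : IsWeightFn ω)
    (h : ∀ lam > (0 : ℝ), ∃ C > (0 : ℝ), ∀ (α : Fin n → ℕ) (σ : List (Fin n)) (x : En n) (B : ℝ),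
      Majorizes ω lam (σ.length + (multiWord α).length) B →
        ‖coordWord σ (partialWord (multiWord α) u) x‖ ≤ C * B) : Cond1 ω u := by
  refine ⟨fun lam hlam α => ?_, fun lam hlam α => ?_⟩
  · obtain ⟨μ, hμ, C, hC, hexp⟩ :=
      hω.exists_exp_mul_le_of_abs_pow_le n 1 le_rfl (multiWord α).length lam hlam
    obtain ⟨A, hA, h⟩ := h μ hμ
    refine ⟨C * A, fun x => hexp x A _ hA.le (norm_nonneg _) (fun B hB => ?_) fun i k B hB => ?_⟩
    · rw [norm_Dmulti_apply]
      exact h α [] x B (by simpa using hB)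
    · have := h α (List.replicate k i) x B (by simpa using hB)
      rw [coordWord_replicate_apply, norm_mul, Complex.norm_real, norm_pow,
        Real.norm_eq_abs] at this
      rwa [norm_Dmulti_apply, one_pow, mul_one]
  · have hu : PureDerivBound ω u := by
      refine ⟨1, le_rfl, 0, fun lam hlam => ?_⟩
      obtain ⟨C, hC, h⟩ := h lam hlam
      refine ⟨C, hC, fun i k σ x B hB => ?_⟩
      rw [one_pow, mul_one, ← multiWord_single]
      refine h _ σ x B ?_
      rw [multiWord_single, List.length_replicate, add_comm]
      exact hB
    simp only [norm_Dmulti_apply, FTn_eq_angularFT, partialWord_angularFT, angularFT_smul,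
      smul_apply, norm_smul, norm_pow, norm_neg, Complex.norm_I, one_pow, one_mul]
    exact (hu.coordWord (multiWord α)).exists_exp_mul_norm_angularFT_le hω lam hlam

theorem statement12 (ω : ℝ → ℝ) (hω : IsWeightFn ω) (u : 𝓢(En n, ℂ)) :
    Cond1 ω u ↔
      (∀ lam > (0 : ℝ), ∃ C > (0 : ℝ), ∀ (α β : Fin n → ℕ) (x : En n),
        ENNReal.ofReal (|xpow β x| * ‖Dmulti α ⇑u x‖) ≤
          ENNReal.ofReal C * expPhiStar ω lam ((∑ i, α i) + ∑ i, β i)) := by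
  constructor
  · intro h lam hlam
    obtain ⟨C, hC, hb⟩ := exists_norm_coordWord_partialWord_le_of_cond1 h hω lam hlam
    exact ⟨C, hC, (forall_ofReal_le_expPhiStar_iff ω u lam C hC).2 fun α => hb (multiWord α)⟩
  · intro h
    refine cond1_of_norm_coordWord_partialWord_le hω fun lam hlam => ?_
    obtain ⟨C, hC, hb⟩ := h lam hlam
    exact ⟨C, hC, (forall_ofReal_le_expPhiStar_iff ω u lam C hC).1 hb⟩
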